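/- For every formula φ such that the sequent ⇒ φ is provable in 𝔊: the sequent ⇒ □φ is provable in 𝔊, and every derivation of ⇒ □φ in 𝔊 makes use of the cut rule (⇒ □φ is not cut-free provable). -/

import Mathlib

/-- Formulas built from propositional variables and the constant `⊥`
by the connectives `∧`, `∨`, `¬`, `□`. -/
inductive FormulaB : Type where
  | var : ℕ → FormulaB
  | bot : FormulaB
  | and : FormulaB → FormulaB → FormulaB
  | or : FormulaB → FormulaB → FormulaB
  | neg : FormulaB → FormulaB
  | box : FormulaB → FormulaB
deriving DecidableEq
/-- The Font–Rius sequent calculus 𝔊.  `Gder c Δ α` means the sequent `Δ ⇒ α` has a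
derivation; when `c = false` the cut rule is not allowed (cut-free derivability),
`Gder true` is plain derivability. -/
inductive Gder : Bool → Finset FormulaB → FormulaB → Prop where
  | ax (c : Bool) (α : FormulaB) : Gder c {α} α
  | modal (c : Bool) (α : FormulaB) : Gder c ∅ (α.or α.box.neg)
  | weak {c Δ α} (β : FormulaB) : Gder c Δ α → Gder c (insert β Δ) α
  | cut {Δ : Finset FormulaB} {α β : FormulaB} :
      Gder true Δ α → Gder true (insert α Δ) β → Gder true Δ β
  | andL {c Δ γ} (α β : FormulaB) :
      Gder c (insert α (insert β Δ)) γ → Gder c (insert (α.and β) Δ) γ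
  | andR {c Δ} {α β : FormulaB} : Gder c Δ α → Gder c Δ β → Gder c Δ (α.and β)
  | orL {c Δ γ} (α β : FormulaB) :
      Gder c (insert α Δ) γ → Gder c (insert β Δ) γ → Gder c (insert (α.or β) Δ) γ
  | orR1 {c Δ} {α : FormulaB} (β : FormulaB) : Gder c Δ α → Gder c Δ (α.or β)
  | orR2 {c Δ} (α : FormulaB) {β : FormulaB} : Gder c Δ β → Gder c Δ (α.or β)
  | negRule {c} {α β : FormulaB} : Gder c {α} β → Gder c {β.neg} α.neg
  | botRule {c Δ} (α : FormulaB) : Gder c Δ FormulaB.bot → Gder c Δ α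
  | nnL {c Δ β} (α : FormulaB) : Gder c (insert α Δ) β → Gder c (insert α.neg.neg Δ) β
  | nnR {c Δ} {α : FormulaB} : Gder c Δ α → Gder c Δ α.neg.neg
  | boxL {c Δ β} (α : FormulaB) :
      Gder c (insert α (insert α.neg Δ)) β → Gder c (insert α (insert α.box.neg Δ)) β
  | boxR {c Δ} {α : FormulaB} :
      Gder c Δ (α.and α.neg) → Gder c Δ (α.and α.box.neg)

/-- Necessitation is derivable in 𝔊 (with cut). -/
theorem Gder.necessitation {φ : FormulaB} (h : Gder true ∅ φ) : Gder true ∅ φ.box := by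
  have h1 : Gder true {φ.box.neg} φ.neg := by
    refine .cut (α := φ) (.weak _ h) ?_
    exact .boxL (Δ := ∅) φ (.weak φ (.ax true φ.neg))
  have h2 : Gder true {φ.neg.neg} φ.box.neg.neg := .negRule h1
  have h3 : Gder true ∅ φ.box.neg.neg := .cut (.nnR h) h2
  exact .cut h3 (.nnL φ.box (.ax true φ.box))

/-- No cut-free derivation with empty antecedent ends in `⊥` or in a boxed formula. -/
theorem Gder.cutFree_empty_ne_bot_and_ne_box {c : Bool} {Δ : Finset FormulaB} {α : FormulaB}
    (h : Gder c Δ α) (hc : c = false) (hΔ : Δ = ∅) :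
    α ≠ FormulaB.bot ∧ ∀ β : FormulaB, α ≠ β.box := by
  induction h with
  | botRule α _ ih => exact absurd rfl (ih hc hΔ).1
  | _ => simp_all

/-- If `⇒ φ` is provable in 𝔊 then `⇒ □φ` is provable in 𝔊, and every derivation
of `⇒ □φ` in 𝔊 makes use of the cut rule. -/
theorem box_of_theorem_needs_cut (φ : FormulaB) (h : Gder true ∅ φ) :
    Gder true ∅ φ.box ∧ ¬ Gder false ∅ φ.box :=
  ⟨h.necessitation, fun hd => (hd.cutFree_empty_ne_bot_and_ne_box rfl rfl).2 φ rfl⟩
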